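/- arXiv:2010.09513 — 2 statements merged into one kernel-verified Lean document; each statement's English description precedes it below -/
import Mathlib

section
/- For every n ≥ 1, the polynomials C_n^E(x) and C_n^O(x) satisfy the recurrence system C_{n+1}^E(x) = (2nx+1)·C_n^E(x) + 2x(1−x)·(C_n^E)′(x) + x·C_n^O(x) and C_{n+1}^O(x) = ((2n−1)x+2)·C_n^O(x) + 2x(1−x)·(C_n^O)′(x) + C_n^E(x), with initial conditions C_1^E(x) = C_1^O(x) = 1. -/
open Polynomial Finset

/-- A signed permutation of rank `n`, encoded as a permutation of `Fin n`
together with a sign for each position. -/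
abbrev SPerm (n : ℕ) := Equiv.Perm (Fin n) × (Fin n → Bool)

/-- The value `π(i)` of a signed permutation at position `i ∈ [n]` (1-indexed),
with the convention `π(0) = 0` (and value `0` outside `[0, n]`). -/
def sval (n : ℕ) (π : SPerm n) (i : ℕ) : ℤ :=
  if h : 1 ≤ i ∧ i ≤ n then
    (if π.2 ⟨i - 1, by omega⟩ then -1 else 1) * ((π.1 ⟨i - 1, by omega⟩ : Fin n).val + 1)
  else 0

/-- `des_A(π) = #{i ∈ [n-1] : π(i) > π(i+1)}`. -/
def desA (n : ℕ) (π : SPerm n) : ℕ :=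
  ((Finset.Icc 1 (n - 1)).filter (fun i => sval n π (i + 1) < sval n π i)).card

/-- `des_B(π) = #{i ∈ {0,…,n-1} : π(i) > π(i+1)}`, where `π(0) = 0`. -/
def desB (n : ℕ) (π : SPerm n) : ℕ :=
  ((Finset.Icc 0 (n - 1)).filter (fun i => sval n π (i + 1) < sval n π i)).card

/-- The flag descent number `fdes(π)`. -/
def fdes (n : ℕ) (π : SPerm n) : ℕ :=
  if sval n π 1 < 0 then 2 * desA n π + 1 else 2 * desA n π

/-- The flag descent polynomial `C_n(x) = Σ_{π ∈ B_n} x^{fdes(π)}`. -/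
noncomputable def Cpoly (n : ℕ) : Polynomial ℝ :=
  ∑ π : SPerm n, X ^ fdes n π

/-- The type `B` Eulerian polynomial `B_n(x) = Σ_{π ∈ B_n} x^{des_B(π)}`. -/
noncomputable def Bpoly (n : ℕ) : Polynomial ℝ :=
  ∑ π : SPerm n, X ^ desB n π

/-- `C_n^E(x) = Σ_{π ∈ B_n, π(1) > 0} x^{des_A(π)}`. -/
noncomputable def CEpoly (n : ℕ) : Polynomial ℝ :=
  ∑ π ∈ Finset.univ.filter (fun π : SPerm n => 0 < sval n π 1), X ^ desA n π

/-- `C_n^O(x) = Σ_{π ∈ B_n, π(1) < 0} x^{des_A(π)}`. -/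
noncomputable def COpoly (n : ℕ) : Polynomial ℝ :=
  ∑ π ∈ Finset.univ.filter (fun π : SPerm n => sval n π 1 < 0), X ^ desA n π

/-- The number of descents among the first `m` adjacent pairs of a sequence. -/
def seqDes (m : ℕ) (b : ℕ → ℤ) : ℕ :=
  ∑ i ∈ range m, if b (i + 1) < b i then 1 else 0

/-- The sequence `b` with the value `v` inserted at position `q`. -/
def seqInsert (q : ℕ) (v : ℤ) (b : ℕ → ℤ) (i : ℕ) : ℤ :=
  if i < q then b i else if i = q then v else b (i - 1)

lemma seqDes_congr {m : ℕ} {b c : ℕ → ℤ} (h : ∀ i ≤ m, b i = c i) :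
    seqDes m b = seqDes m c := by
  refine sum_congr rfl fun i hi => ?_
  rw [mem_range] at hi
  rw [h i (by omega), h (i + 1) (by omega)]

lemma seqDes_succ (m : ℕ) (b : ℕ → ℤ) :
    seqDes (m + 1) b = seqDes m b + if b (m + 1) < b m then 1 else 0 :=
  sum_range_succ _ _

lemma seqDes_insert_zero (m : ℕ) (v : ℤ) (b : ℕ → ℤ) :
    seqDes (m + 1) (seqInsert 0 v b) = seqDes m b + if b 0 < v then 1 else 0 := by
  rw [seqDes, sum_range_succ']
  simp [seqInsert, seqDes]

lemma seqDes_insert_of_lt {m q : ℕ} (h : m < q) (v : ℤ) (b : ℕ → ℤ) :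
    seqDes m (seqInsert q v b) = seqDes m b :=
  seqDes_congr fun i hi => by simp [seqInsert, show i < q by omega]

lemma seqDes_insert_last (m : ℕ) (v : ℤ) (b : ℕ → ℤ) :
    seqDes (m + 1) (seqInsert (m + 1) v b) = seqDes m b + if v < b m then 1 else 0 := by
  rw [seqDes_succ, seqDes_insert_of_lt (by omega)]
  simp [seqInsert]

lemma seqDes_insert_succ {m k : ℕ} (hk : k < m) (v : ℤ) (b : ℕ → ℤ) :
    seqDes (m + 1) (seqInsert (k + 1) v b) + (if b (k + 1) < b k then 1 else 0) =
      seqDes m b + ((if v < b k then 1 else 0) + if b (k + 1) < v then 1 else 0) := by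
  induction m, hk using Nat.le_induction with
  | base =>
    rw [seqDes_succ, seqDes_insert_last, seqDes_succ k b]
    simp only [seqInsert, show ¬ k + 1 + 1 < k + 1 by omega, show ¬ k + 1 + 1 = k + 1 by omega,
      lt_irrefl, if_true, if_false, Nat.add_sub_cancel]
    omega
  | succ m hm ih =>
    rw [seqDes_succ, seqDes_succ m b]
    have h1 : seqInsert (k + 1) v b (m + 1 + 1) = b (m + 1) := by
      simp [seqInsert, show ¬ m + 1 + 1 < k + 1 by omega, show ¬ m + 1 = k by omega]
    have h2 : seqInsert (k + 1) v b (m + 1) = b m := by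
      simp [seqInsert, show ¬ m < k by omega, show ¬ m = k by omega]
    rw [h1, h2]
    omega

lemma sum_pow_seqDes_insert_interior {m : ℕ} {v : ℤ} {b : ℕ → ℤ}
    (hv : (∀ i, b i < v) ∨ ∀ i, v < b i) :
    ∑ k ∈ range m, (X : ℝ[X]) ^ seqDes (m + 1) (seqInsert (k + 1) v b) =
      (m : ℝ[X]) * X ^ (seqDes m b + 1) +
        (seqDes m b : ℝ[X]) * (X ^ seqDes m b - X ^ (seqDes m b + 1)) := by
  have key : ∀ k ∈ range m, (X : ℝ[X]) ^ seqDes (m + 1) (seqInsert (k + 1) v b) =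
      X ^ (seqDes m b + 1) + ((if b (k + 1) < b k then 1 else 0 : ℕ) : ℝ[X]) *
        (X ^ seqDes m b - X ^ (seqDes m b + 1)) := by
    intro k hk
    have h := seqDes_insert_succ (mem_range.1 hk) v b
    have h' : (if v < b k then 1 else 0) + (if b (k + 1) < v then 1 else 0) = 1 := by
      rcases hv with hv | hv
      · simp [hv, (hv k).le]
      · simp [hv, (hv (k + 1)).le]
    rw [h'] at h
    split_ifs at h ⊢
    · simp [show seqDes (m + 1) (seqInsert (k + 1) v b) = seqDes m b by omega]
    · simp [show seqDes (m + 1) (seqInsert (k + 1) v b) = seqDes m b + 1 by omega]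
  rw [sum_congr rfl key, sum_add_distrib, ← sum_mul, ← Nat.cast_sum]
  simp [seqDes]

/-- Insert the letter `n + 1`, negated if `s` holds, at position `p` of a signed permutation
of rank `n`. -/
def insertMax (n : ℕ) (x : SPerm n × Fin (n + 1) × Bool) : SPerm (n + 1) :=
  ((finSuccEquiv' x.2.1).trans ((Equiv.optionCongr x.1.1).trans (finSuccEquiv' (Fin.last n)).symm),
    x.2.1.insertNth x.2.2 x.1.2)

lemma insertMax_fst_self {n : ℕ} (π : SPerm n) (p : Fin (n + 1)) (s : Bool) :
    (insertMax n (π, p, s)).1 p = Fin.last n := by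
  simp [insertMax]

lemma insertMax_fst_succAbove {n : ℕ} (π : SPerm n) (p : Fin (n + 1)) (s : Bool) (j : Fin n) :
    (insertMax n (π, p, s)).1 (p.succAbove j) = (π.1 j).castSucc := by
  simp [insertMax]

lemma insertMax_injective (n : ℕ) : Function.Injective (insertMax n) := by
  rintro ⟨⟨σ, ε⟩, p, s⟩ ⟨⟨τ, δ⟩, q, t⟩ h
  have hpq : p = q := by
    apply (insertMax n ((σ, ε), p, s)).1.injective
    rw [insertMax_fst_self, h, insertMax_fst_self]
  subst hpq
  have hσ : σ = τ := by
    ext j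
    have := insertMax_fst_succAbove (σ, ε) p s j
    rw [h, insertMax_fst_succAbove] at this
    simpa using congrArg Fin.val this.symm
  have h2 : p.insertNth (α := fun _ => Bool) s ε = p.insertNth t δ := congrArg Prod.snd h
  have hs : s = t := by simpa using congrFun h2 p
  have hε : ε = δ := by
    ext j
    simpa using congrFun h2 (p.succAbove j)
  rw [hσ, hs, hε]

lemma insertMax_bijective (n : ℕ) : Function.Bijective (insertMax n) := by
  rw [Fintype.bijective_iff_injective_and_card]
  refine ⟨insertMax_injective n, ?_⟩
  simp [Fintype.card_perm, Nat.factorial_succ, pow_succ]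
  ring

lemma sval_fin {n : ℕ} (π : SPerm n) (j : Fin n) :
    sval n π (j + 1) = (if π.2 j then -1 else 1) * ((π.1 j : ℕ) + 1) := by
  simp [sval]

lemma sval_bounds {n : ℕ} (π : SPerm n) (i : ℕ) :
    -((n : ℤ) + 1) < sval n π i ∧ sval n π i < n + 1 := by
  unfold sval
  split_ifs with h h'
  · have := (π.1 ⟨i - 1, by omega⟩).2
    omega
  · have := (π.1 ⟨i - 1, by omega⟩).2
    omega
  · omega

lemma sval_insertMax {n : ℕ} (π : SPerm n) (p : Fin (n + 1)) (s : Bool) {i : ℕ} (hi : i ≤ n) :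
    sval (n + 1) (insertMax n (π, p, s)) (i + 1) =
      seqInsert p (if s then -((n : ℤ) + 1) else n + 1) (fun i => sval n π (i + 1)) i := by
  obtain ⟨i, rfl⟩ : ∃ i' : Fin (n + 1), (i' : ℕ) = i := ⟨⟨i, by omega⟩, rfl⟩
  rw [sval_fin]
  rcases Fin.eq_self_or_eq_succAbove p i with rfl | ⟨j, rfl⟩
  · rw [insertMax_fst_self]
    cases s <;> simp [insertMax, seqInsert]
  · rw [insertMax_fst_succAbove]
    have hj := sval_fin π j
    by_cases hjp : j.castSucc < p
    · have : (j : ℕ) < p := hjp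
      simp [insertMax, seqInsert, Fin.succAbove_of_castSucc_lt p j hjp, this, hj]
      simp [← Fin.succAbove_of_castSucc_lt p j hjp]
    · have hp : (p : ℕ) ≤ j := not_lt.1 hjp
      have hs := Fin.succAbove_of_le_castSucc p j (not_lt.1 hjp)
      have hv : ((p.succAbove j : Fin (n + 1)) : ℕ) = j + 1 := by rw [hs]; rfl
      simp [insertMax, seqInsert, hv, hj, show ¬ (j : ℕ) + 1 < p by omega,
        show ¬ (j : ℕ) + 1 = p by omega]

lemma desA_succ (m : ℕ) (π : SPerm (m + 1)) :
    desA (m + 1) π = seqDes m fun i => sval (m + 1) π (i + 1) := by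
  rw [desA, card_filter, seqDes, Nat.add_sub_cancel, range_eq_Ico,
    sum_Ico_add' (fun i => if sval (m + 1) π (i + 1) < sval (m + 1) π i then 1 else 0) 0 m 1]
  rfl

lemma sval_one_ne_zero (m : ℕ) (π : SPerm (m + 1)) : sval (m + 1) π 1 ≠ 0 := by
  have := sval_fin π 0
  simp only [Fin.val_zero, zero_add] at this
  rw [this]
  split_ifs <;> omega

lemma desA_insertMax {m : ℕ} (π : SPerm (m + 1)) (p : Fin (m + 2)) (s : Bool) :
    desA (m + 2) (insertMax (m + 1) (π, p, s)) =
      seqDes (m + 1) (seqInsert p (if s then -((m + 1 : ℕ) + 1 : ℤ) else (m + 1 : ℕ) + 1)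
        fun i => sval (m + 1) π (i + 1)) := by
  rw [desA_succ (m + 1)]
  exact seqDes_congr fun i hi => sval_insertMax π p s hi

lemma CEpoly_succ (m : ℕ) : CEpoly (m + 1) =
    ∑ π : SPerm (m + 1), if 0 < sval (m + 1) π 1 then X ^ desA (m + 1) π else 0 :=
  sum_filter _ _

lemma COpoly_succ (m : ℕ) : COpoly (m + 1) =
    ∑ π : SPerm (m + 1), if 0 < sval (m + 1) π 1 then 0 else X ^ desA (m + 1) π := by
  rw [COpoly, sum_filter]
  refine sum_congr rfl fun π _ => ?_
  have := sval_one_ne_zero m π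
  split_ifs <;> first | rfl | omega

lemma sum_SPerm_succ {m : ℕ} (f : SPerm (m + 2) → ℝ[X]) :
    ∑ π, f π = ∑ π : SPerm (m + 1),
      ((f (insertMax (m + 1) (π, 0, false)) + f (insertMax (m + 1) (π, 0, true))) +
        ∑ q : Fin (m + 1), (f (insertMax (m + 1) (π, q.succ, false)) +
          f (insertMax (m + 1) (π, q.succ, true)))) := by
  rw [← (insertMax_bijective (m + 1)).sum_comp, Fintype.sum_prod_type]
  refine sum_congr rfl fun π _ => ?_
  rw [Fintype.sum_prod_type, Fin.sum_univ_succ]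
  simp [add_comm]

lemma sval_one_insertMax_zero {m : ℕ} (π : SPerm (m + 1)) (s : Bool) :
    0 < sval (m + 2) (insertMax (m + 1) (π, 0, s)) 1 ↔ s = false := by
  have := sval_insertMax π 0 s (Nat.zero_le _)
  rw [zero_add] at this
  rw [this]
  cases s <;> simp [seqInsert] <;> omega

lemma sval_one_insertMax_succ {m : ℕ} (π : SPerm (m + 1)) (q : Fin (m + 1)) (s : Bool) :
    sval (m + 2) (insertMax (m + 1) (π, q.succ, s)) 1 = sval (m + 1) π 1 := by
  have := sval_insertMax π q.succ s (Nat.zero_le _)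
  rw [zero_add] at this
  rw [this]
  simp [seqInsert]

lemma desA_insertMax_zero_false {m : ℕ} (π : SPerm (m + 1)) :
    desA (m + 2) (insertMax (m + 1) (π, 0, false)) = desA (m + 1) π + 1 := by
  rw [desA_insertMax, Fin.val_zero, seqDes_insert_zero, desA_succ]
  have := (sval_bounds π (0 + 1)).2
  simp only [Bool.false_eq_true, if_false, if_pos this]

lemma desA_insertMax_zero_true {m : ℕ} (π : SPerm (m + 1)) :
    desA (m + 2) (insertMax (m + 1) (π, 0, true)) = desA (m + 1) π := by
  rw [desA_insertMax, Fin.val_zero, seqDes_insert_zero, desA_succ]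
  have := (sval_bounds π (0 + 1)).1
  simp only [if_true, if_neg this.le.not_gt, add_zero]

lemma sum_pow_desA_insertMax_succ {m : ℕ} (π : SPerm (m + 1)) :
    ∑ q : Fin (m + 1), ((X : ℝ[X]) ^ desA (m + 2) (insertMax (m + 1) (π, q.succ, false)) +
        X ^ desA (m + 2) (insertMax (m + 1) (π, q.succ, true))) =
      X ^ desA (m + 1) π * (1 + 2 * (desA (m + 1) π : ℝ[X]) +
        (2 * (m : ℝ[X]) + 1 - 2 * (desA (m + 1) π : ℝ[X])) * X) := by
  simp only [desA_insertMax, Fin.val_succ, sum_add_distrib, Bool.false_eq_true, if_true, if_false]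
  have hb := fun i => sval_bounds π (i + 1)
  rw [Fin.sum_univ_eq_sum_range (fun q => (X : ℝ[X]) ^ seqDes (m + 1) (seqInsert (q + 1)
      ((m + 1 : ℕ) + 1) fun i => sval (m + 1) π (i + 1))),
    Fin.sum_univ_eq_sum_range (fun q => (X : ℝ[X]) ^ seqDes (m + 1) (seqInsert (q + 1)
      (-((m + 1 : ℕ) + 1)) fun i => sval (m + 1) π (i + 1))),
    sum_range_succ, sum_range_succ,
    sum_pow_seqDes_insert_interior (.inl fun i => (hb i).2),
    sum_pow_seqDes_insert_interior (.inr fun i => (hb i).1),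
    seqDes_insert_last, seqDes_insert_last, if_neg (hb m).2.le.not_gt, if_pos (hb m).1, desA_succ]
  ring

lemma X_mul_derivative_X_pow (d : ℕ) :
    (X : ℝ[X]) * derivative (X ^ d) = (d : ℝ[X]) * X ^ d := by
  cases d with
  | zero => simp
  | succ d => rw [derivative_X_pow]; simp; ring

lemma desA_one (π : SPerm 1) : desA 1 π = 0 := by
  simp [desA]

lemma CEpoly_one : CEpoly 1 = 1 := by
  have h : #{π : SPerm 1 | 0 < sval 1 π 1} = 1 := by decide
  simp [CEpoly, desA_one, h]

lemma COpoly_one : COpoly 1 = 1 := by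
  have h : #{π : SPerm 1 | sval 1 π 1 < 0} = 1 := by decide
  simp [COpoly, desA_one, h]

/-- For every `n ≥ 1`, the polynomials `C_n^E` and `C_n^O` satisfy the Eulerian
recurrence system
`C_{n+1}^E = (2nx+1)C_n^E + 2x(1-x)(C_n^E)' + x C_n^O`,
`C_{n+1}^O = ((2n-1)x+2)C_n^O + 2x(1-x)(C_n^O)' + C_n^E`,
with initial conditions `C_1^E = C_1^O = 1`. -/
theorem CE_CO_recurrence_system :
    CEpoly 1 = 1 ∧ COpoly 1 = 1 ∧
    ∀ n : ℕ, 1 ≤ n →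
      CEpoly (n + 1) =
        (Polynomial.C (2 * (n : ℝ)) * X + 1) * CEpoly n +
          2 * X * (1 - X) * derivative (CEpoly n) + X * COpoly n ∧
      COpoly (n + 1) =
        (Polynomial.C (2 * (n : ℝ) - 1) * X + 2) * COpoly n +
          2 * X * (1 - X) * derivative (COpoly n) + CEpoly n := by
  refine ⟨CEpoly_one, COpoly_one, fun n hn => ?_⟩
  have hC : (C 2 : ℝ[X]) = 2 := map_ofNat C 2
  obtain ⟨m, rfl⟩ : ∃ m, n = m + 1 := ⟨n - 1, by omega⟩
  rw [CEpoly_succ (m + 1), COpoly_succ (m + 1), sum_SPerm_succ, sum_SPerm_succ,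
    CEpoly_succ m, COpoly_succ m]
  simp only [derivative_sum, mul_sum, ← sum_add_distrib]
  constructor <;> refine sum_congr rfl fun π _ => ?_ <;>
    simp only [sval_one_insertMax_zero, sval_one_insertMax_succ, desA_insertMax_zero_false,
      desA_insertMax_zero_true] <;>
    have hd := X_mul_derivative_X_pow (desA (m + 1) π) <;>
    by_cases h : 0 < sval (m + 1) π 1 <;>
    simp [h, sum_pow_desA_insertMax_succ, hC] <;>
    first | ring1 | linear_combination (-2 * (1 - X)) * hd
end

section
/- For every n ≥ 1, B_n(x) = A_n(x) + x·Σ_{k=0}^{n−1} binom(n,k)·A_k(x)·C_{n−k}^O(x). -/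
open Polynomial Finset

/-- The value `π(i)` of a permutation of `[n]` at position `i ∈ [n]`
(1-indexed), with `π(0) = 0`. -/
def pval (n : ℕ) (π : Equiv.Perm (Fin n)) (i : ℕ) : ℤ :=
  if h : 1 ≤ i ∧ i ≤ n then ((π ⟨i - 1, by omega⟩ : Fin n).val + 1 : ℤ) else 0

/-- The descent number of a permutation of `[n]`. -/
def desS (n : ℕ) (π : Equiv.Perm (Fin n)) : ℕ :=
  ((Finset.Icc 1 (n - 1)).filter (fun i => pval n π (i + 1) < pval n π i)).card

/-- The Eulerian polynomial `A_n(x) = Σ_{π ∈ S_n} x^{des(π)}`. -/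
noncomputable def Apoly (n : ℕ) : Polynomial ℝ :=
  ∑ π : Equiv.Perm (Fin n), X ^ desS n π

lemma card_compl_of_card_eq {k m : ℕ} (s : {s : Finset (Fin (k + m)) // s.card = k}) :
    (s.1ᶜ).card = m := by
  simp [Finset.card_compl, s.2]

/-- The permutation of `Fin (k + m)` whose first `k` values form the set `s`, ordered as in `p.1`,
and whose last `m` values form the complement of `s`, ordered as in `p.2`. -/
def shuffle {k m : ℕ} (s : {s : Finset (Fin (k + m)) // s.card = k})
    (p : Equiv.Perm (Fin k) × Equiv.Perm (Fin m)) : Equiv.Perm (Fin (k + m)) :=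
  finSumFinEquiv.symm.trans ((Equiv.sumCongr p.1 p.2).trans
    (finSumEquivOfFinset s.2 (card_compl_of_card_eq s)))

lemma shuffle_castAdd {k m : ℕ} (s : {s : Finset (Fin (k + m)) // s.card = k})
    (p : Equiv.Perm (Fin k) × Equiv.Perm (Fin m)) (i : Fin k) :
    shuffle s p (Fin.castAdd m i) = s.1.orderEmbOfFin s.2 (p.1 i) := by
  simp [shuffle]

lemma shuffle_natAdd {k m : ℕ} (s : {s : Finset (Fin (k + m)) // s.card = k})
    (p : Equiv.Perm (Fin k) × Equiv.Perm (Fin m)) (j : Fin m) :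
    shuffle s p (Fin.natAdd k j) = s.1ᶜ.orderEmbOfFin (card_compl_of_card_eq s) (p.2 j) := by
  simp [shuffle]

lemma image_shuffle_castAdd {k m : ℕ} (s : {s : Finset (Fin (k + m)) // s.card = k})
    (p : Equiv.Perm (Fin k) × Equiv.Perm (Fin m)) :
    Finset.univ.image (fun i => shuffle s p (Fin.castAdd m i)) = s.1 := by
  apply Finset.eq_of_subset_of_card_le
  · intro x hx
    obtain ⟨i, -, rfl⟩ := Finset.mem_image.1 hx
    simp only [shuffle_castAdd]
    exact Finset.orderEmbOfFin_mem _ _ _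
  · have h := (shuffle s p).injective.comp (Fin.castAdd_injective k m)
    exact ((Finset.card_image_of_injective Finset.univ h).trans (by simp [s.2])).ge

lemma shuffle_bijective (k m : ℕ) :
    Function.Bijective (fun q : {s : Finset (Fin (k + m)) // s.card = k} ×
      (Equiv.Perm (Fin k) × Equiv.Perm (Fin m)) => shuffle q.1 q.2) := by
  rw [Fintype.bijective_iff_injective_and_card]
  constructor
  · rintro ⟨s, p⟩ ⟨t, q⟩ h
    dsimp only at h
    obtain rfl : s = t := by
      apply Subtype.ext
      rw [← image_shuffle_castAdd s p, ← image_shuffle_castAdd t q, h]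
    have h₁ : p.1 = q.1 := by
      ext i : 1
      have := shuffle_castAdd s p i
      rw [h, shuffle_castAdd] at this
      exact ((s.1.orderEmbOfFin s.2).injective this).symm
    have h₂ : p.2 = q.2 := by
      ext i : 1
      have := shuffle_natAdd s p i
      rw [h, shuffle_natAdd] at this
      exact ((s.1ᶜ.orderEmbOfFin _).injective this).symm
    rw [Prod.ext h₁ h₂]
  · simp only [Fintype.card_prod, Fintype.card_finset_len, Fintype.card_perm, Fintype.card_fin]
    rw [← mul_assoc, Nat.choose_symm_add, Nat.add_choose_mul_factorial_mul_factorial]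

/-- The number of leading positions of a sign vector that carry a positive sign. -/
def leadingPos {n : ℕ} (ε : Fin n → Bool) : ℕ :=
  Nat.find (p := fun i => ∀ h : i < n, ε ⟨i, h⟩ = true) ⟨n, fun h => absurd h (lt_irrefl n)⟩

lemma leadingPos_eq_iff {n : ℕ} (ε : Fin n → Bool) (k : ℕ) (hk : k ≤ n) :
    leadingPos ε = k ↔
      (∀ h : k < n, ε ⟨k, h⟩ = true) ∧ ∀ i (h : i < k), ε ⟨i, h.trans_le hk⟩ = false := by
  rw [leadingPos, Nat.find_eq_iff]
  refine and_congr_right fun _ => forall₂_congr fun i hi => ?_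
  simp [hi.trans_le hk]

lemma leadingPos_le {n : ℕ} (ε : Fin n → Bool) : leadingPos ε ≤ n :=
  Nat.find_min' _ fun h => absurd h (lt_irrefl n)

lemma leadingPos_eq_self_iff {n : ℕ} (ε : Fin n → Bool) :
    leadingPos ε = n ↔ ε = fun _ => false := by
  rw [leadingPos_eq_iff ε n le_rfl]
  constructor
  · intro h
    ext i : 1
    exact h.2 i i.2
  · rintro rfl
    simp

lemma sum_leadingPos_eq {M : Type*} [AddCommMonoid M] (k m : ℕ)
    (g : (Fin (k + (m + 1)) → Bool) → M) :
    ∑ ε with leadingPos ε = k, g ε =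
      ∑ ε : Fin (m + 1) → Bool with ε 0 = true, g (Fin.append (fun _ => false) ε) := by
  symm
  refine Finset.sum_nbij' (fun ε => Fin.append (fun _ => false) ε)
    (fun ε j => ε (Fin.natAdd k j)) ?_ ?_ ?_ ?_ ?_
  · intro ε hε
    simp only [Finset.mem_filter, Finset.mem_univ, true_and] at hε ⊢
    rw [leadingPos_eq_iff _ _ (by omega)]
    refine ⟨fun h => ?_, fun i h => ?_⟩
    · exact (Fin.append_right _ ε 0).trans hε
    · exact Fin.append_left (fun _ => false) ε ⟨i, h⟩
  · intro ε hε
    simp only [Finset.mem_filter, Finset.mem_univ, true_and] at hε ⊢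
    rw [leadingPos_eq_iff _ _ (by omega)] at hε
    exact hε.1 (by omega)
  · intro ε _
    ext j : 1
    simp
  · intro ε hε
    simp only [Finset.mem_filter, Finset.mem_univ, true_and] at hε
    rw [leadingPos_eq_iff _ _ (by omega)] at hε
    ext i : 1
    induction i using Fin.addCases with
    | left i => exact (Fin.append_left _ _ i).trans (hε.2 i i.2).symm
    | right j => simp
  · intro ε _
    rfl

lemma desB_eq_sum {n : ℕ} (hn : 1 ≤ n) (π : SPerm n) :
    desB n π = ∑ i ∈ Finset.range n, if sval n π (i + 1) < sval n π i then 1 else 0 := by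
  rw [desB, Finset.card_filter]
  congr 1
  ext i
  simp only [Finset.mem_Icc, Finset.mem_range]
  omega

lemma desA_succ_eq_sum (m : ℕ) (π : SPerm (m + 1)) :
    desA (m + 1) π = ∑ i ∈ Finset.range m,
      if sval (m + 1) π (i + 1 + 1) < sval (m + 1) π (i + 1) then 1 else 0 := by
  rw [desA, Finset.card_filter, Finset.range_eq_Ico, Finset.sum_Ico_add'
    (fun i => if sval (m + 1) π (i + 1) < sval (m + 1) π i then 1 else 0)]
  congr 1

lemma pval_succ {n : ℕ} (σ : Equiv.Perm (Fin n)) (i : Fin n) :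
    pval n σ (i + 1) = (σ i : ℕ) + 1 := by
  simp [pval]

lemma pval_zero {n : ℕ} (σ : Equiv.Perm (Fin n)) : pval n σ 0 = 0 := by
  simp [pval]

lemma sval_zero {n : ℕ} (π : SPerm n) : sval n π 0 = 0 := by
  simp [sval]

lemma sval_succ {n : ℕ} (π : SPerm n) (i : Fin n) :
    sval n π (i + 1) = (if π.2 i then -1 else 1) * ((π.1 i : ℕ) + 1) := by
  simp [sval]

lemma sval_one_neg_iff {m : ℕ} (π : SPerm (m + 1)) : sval (m + 1) π 1 < 0 ↔ π.2 0 = true := by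
  have h := sval_succ π 0
  simp only [Fin.val_zero, zero_add] at h
  rw [h]
  cases π.2 0 <;> simp <;> omega

lemma desS_eq_sum (n : ℕ) (σ : Equiv.Perm (Fin n)) :
    desS n σ = ∑ i ∈ Finset.range n, if pval n σ (i + 1) < pval n σ i then 1 else 0 := by
  rcases n with _ | n
  · simp [desS, pval]
  · have h := pval_succ σ 0
    simp only [Fin.val_zero, zero_add] at h
    rw [Finset.sum_range_succ', desS, Finset.card_filter, Finset.range_eq_Ico,
      Finset.sum_Ico_add' (fun i => if pval (n + 1) σ (i + 1) < pval (n + 1) σ i then 1 else 0),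
      zero_add, pval_zero, h, if_neg (by omega), add_zero]
    congr 1

lemma desB_of_all_pos {n : ℕ} (hn : 1 ≤ n) (σ : Equiv.Perm (Fin n)) :
    desB n (σ, fun _ => false) = desS n σ := by
  rw [desB_eq_sum hn, desS_eq_sum]
  simp [sval, pval]

section shuffle

variable {k m : ℕ} (s : {s : Finset (Fin (k + m)) // s.card = k})
  (τ : Equiv.Perm (Fin k)) (ρ : Equiv.Perm (Fin m)) (ε : Fin m → Bool)

lemma sval_shuffle_left (i : Fin k) :
    sval (k + m) (shuffle s (τ, ρ), Fin.append (fun _ => false) ε) (i + 1) =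
      (s.1.orderEmbOfFin s.2 (τ i) : ℕ) + 1 := by
  have h := sval_succ (shuffle s (τ, ρ), Fin.append (fun _ => false) ε) (Fin.castAdd m i)
  simpa only [Fin.val_castAdd, Fin.append_left, shuffle_castAdd, Bool.false_eq_true, if_false,
    one_mul] using h

lemma sval_shuffle_right (j : Fin m) :
    sval (k + m) (shuffle s (τ, ρ), Fin.append (fun _ => false) ε) (k + j + 1) =
      (if ε j then -1 else 1) *
        ((s.1ᶜ.orderEmbOfFin (card_compl_of_card_eq s) (ρ j) : ℕ) + 1) := by
  have h := sval_succ (shuffle s (τ, ρ), Fin.append (fun _ => false) ε) (Fin.natAdd k j)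
  simpa only [Fin.val_natAdd, Fin.append_right, shuffle_natAdd] using h

lemma sval_shuffle_left_lt_iff (i : ℕ) (hi : i < k) :
    sval (k + m) (shuffle s (τ, ρ), Fin.append (fun _ => false) ε) (i + 1) <
        sval (k + m) (shuffle s (τ, ρ), Fin.append (fun _ => false) ε) i ↔
      pval k τ (i + 1) < pval k τ i := by
  have h₁ := sval_shuffle_left s τ ρ ε ⟨i, hi⟩
  have h₂ := pval_succ τ ⟨i, hi⟩
  dsimp only at h₁ h₂
  rw [h₁, h₂]
  rcases i with _ | i
  · rw [sval_zero, pval_zero]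
    omega
  · have h₃ := sval_shuffle_left s τ ρ ε ⟨i, by omega⟩
    have h₄ := pval_succ τ ⟨i, by omega⟩
    dsimp only at h₃ h₄
    rw [h₃, h₄]
    simp

lemma sval_shuffle_right_lt_iff (i j : Fin m) :
    sval (k + m) (shuffle s (τ, ρ), Fin.append (fun _ => false) ε) (k + i + 1) <
        sval (k + m) (shuffle s (τ, ρ), Fin.append (fun _ => false) ε) (k + j + 1) ↔
      sval m (ρ, ε) (i + 1) < sval m (ρ, ε) (j + 1) := by
  rw [sval_shuffle_right, sval_shuffle_right, sval_succ, sval_succ]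
  have h₁ := (s.1ᶜ.orderEmbOfFin (card_compl_of_card_eq s)).lt_iff_lt (a := ρ i) (b := ρ j)
  have h₂ := (s.1ᶜ.orderEmbOfFin (card_compl_of_card_eq s)).lt_iff_lt (a := ρ j) (b := ρ i)
  rw [Fin.lt_def, Fin.lt_def] at h₁ h₂
  dsimp only
  split_ifs <;> omega

end shuffle

lemma desB_shuffle {k m : ℕ} (s : {s : Finset (Fin (k + (m + 1))) // s.card = k})
    (τ : Equiv.Perm (Fin k)) (ρ : Equiv.Perm (Fin (m + 1))) (ε : Fin (m + 1) → Bool)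
    (hε : ε 0 = true) :
    desB (k + (m + 1)) (shuffle s (τ, ρ), Fin.append (fun _ => false) ε) =
      desS k τ + 1 + desA (m + 1) (ρ, ε) := by
  rw [desB_eq_sum (by omega), Finset.sum_range_add, Finset.sum_range_succ', desS_eq_sum,
    desA_succ_eq_sum, ← add_assoc, add_right_comm _ 1]
  refine congrArg₂ _ (congrArg₂ _ ?_ ?_) ?_
  · refine Finset.sum_congr rfl fun i hi => ?_
    simp only [sval_shuffle_left_lt_iff s τ ρ ε i (Finset.mem_range.1 hi)]
  · refine Finset.sum_congr rfl fun i hi => ?_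
    have hi := Finset.mem_range.1 hi
    exact if_congr (sval_shuffle_right_lt_iff s τ ρ ε ⟨i + 1, by omega⟩ ⟨i, by omega⟩) rfl rfl
  · have h := sval_shuffle_right s τ ρ ε 0
    simp only [Fin.val_zero, hε, if_true] at h
    rw [add_zero] at h ⊢
    rw [h, if_pos]
    rcases k with _ | k
    · rw [sval_zero]
      omega
    · have h' := sval_shuffle_left s τ ρ ε (Fin.last k)
      rw [Fin.val_last] at h'
      rw [h']
      omega

lemma sum_leadingPos_eq_X_pow_desB (k m : ℕ) :
    ∑ π : SPerm (k + (m + 1)) with leadingPos π.2 = k, (X : ℝ[X]) ^ desB (k + (m + 1)) π =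
      X * (C (((k + (m + 1)).choose k : ℕ) : ℝ) * Apoly k * COpoly (m + 1)) := by
  have hO : COpoly (m + 1) = ∑ ρ : Equiv.Perm (Fin (m + 1)),
      ∑ ε : Fin (m + 1) → Bool with ε 0 = true, X ^ desA (m + 1) (ρ, ε) := by
    simp only [COpoly, sval_one_neg_iff, Finset.sum_filter, Fintype.sum_prod_type]
  calc
    _ = ∑ σ : Equiv.Perm (Fin (k + (m + 1))), ∑ ε with leadingPos ε = k,
        (X : ℝ[X]) ^ desB (k + (m + 1)) (σ, ε) := by
      simp only [Finset.sum_filter, Fintype.sum_prod_type]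
    _ = ∑ σ : Equiv.Perm (Fin (k + (m + 1))), ∑ ε : Fin (m + 1) → Bool with ε 0 = true,
        (X : ℝ[X]) ^ desB (k + (m + 1)) (σ, Fin.append (fun _ => false) ε) :=
      Finset.sum_congr rfl fun σ _ => sum_leadingPos_eq k m _
    _ = ∑ _s : {s : Finset (Fin (k + (m + 1))) // s.card = k},
        ∑ τ : Equiv.Perm (Fin k), ∑ ρ : Equiv.Perm (Fin (m + 1)),
          ∑ ε : Fin (m + 1) → Bool with ε 0 = true,
            X * ((X : ℝ[X]) ^ desS k τ * X ^ desA (m + 1) (ρ, ε)) := by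
      rw [← (shuffle_bijective k (m + 1)).sum_comp]
      simp only [Fintype.sum_prod_type]
      refine Finset.sum_congr rfl fun s _ => Finset.sum_congr rfl fun τ _ =>
        Finset.sum_congr rfl fun ρ _ => Finset.sum_congr rfl fun ε hε => ?_
      rw [desB_shuffle s τ ρ ε (Finset.mem_filter.1 hε).2]
      ring
    _ = _ := by
      rw [Finset.sum_const, Finset.card_univ, Fintype.card_finset_len, Fintype.card_fin, hO, Apoly]
      simp only [← Finset.mul_sum, ← Finset.sum_mul, nsmul_eq_mul, map_natCast]
      ring

/-- For every `n ≥ 1`,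
`B_n(x) = A_n(x) + x · Σ_{k=0}^{n-1} binom(n,k) · A_k(x) · C_{n-k}^O(x)`. -/
theorem typeB_eulerian_convolution (n : ℕ) (hn : 1 ≤ n) :
    Bpoly n =
      Apoly n +
        X * ∑ k ∈ Finset.range n,
          Polynomial.C ((n.choose k : ℝ)) * Apoly k * COpoly (n - k) := by
  have hsum : Bpoly n = ∑ k ∈ Finset.range (n + 1),
      ∑ π : SPerm n with leadingPos π.2 = k, X ^ desB n π :=
    (Finset.sum_fiberwise_of_maps_to
      (fun π _ => Finset.mem_range.2 (Nat.lt_succ_of_le (leadingPos_le π.2))) _).symm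
  rw [hsum, Finset.sum_range_succ, add_comm, Finset.mul_sum]
  congr 1
  · simp only [leadingPos_eq_self_iff, Finset.sum_filter, Fintype.sum_prod_type,
      Finset.sum_ite_eq', Finset.mem_univ, if_true, desB_of_all_pos hn, Apoly]
  · refine Finset.sum_congr rfl fun k hk => ?_
    obtain ⟨m, rfl⟩ := Nat.exists_eq_add_of_lt (Finset.mem_range.1 hk)
    rw [add_assoc, sum_leadingPos_eq_X_pow_desB, Nat.add_sub_cancel_left]
end
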